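/- There exists an absolute constant C > 0 with the following property: for every nonconstant harmonic function u : ℂ → ℝ there exist sequences z_n ∈ ℂ and ρ_n > 0 such that for all n: u(z_n) = 0, M(u, z_n, ρ_n) → +∞ as n → ∞, and M(u, z_n, ρ_n) ≤ C·M(u, z_n, ρ_n/2). -/

import Mathlib

open Complex Metric Filter Set

/-- A function `u : ℂ → ℝ` is harmonic on all of `ℂ` if it is `C²` and its Laplacian
(the sum of the second derivatives in the directions `1` and `I`) vanishes everywhere. -/
def HarmonicFn (u : ℂ → ℝ) : Prop :=
  ContDiff ℝ 2 u ∧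
    ∀ z : ℂ, iteratedFDeriv ℝ 2 u z ![1, 1] + iteratedFDeriv ℝ 2 u z ![Complex.I, Complex.I] = 0

/-- A function `u : ℂ → ℝ` is harmonic on a set `s` if it is `C²` on `s` and its Laplacian
vanishes on `s`. -/
def HarmonicOnSet (u : ℂ → ℝ) (s : Set ℂ) : Prop :=
  ContDiffOn ℝ 2 u s ∧
    ∀ z ∈ s, iteratedFDerivWithin ℝ 2 u s z ![1, 1]
      + iteratedFDerivWithin ℝ 2 u s z ![Complex.I, Complex.I] = 0

/-- The set of asymptotic directions of a set `R ⊆ ℂ`: points `ζ` of the unit circle for which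
there are `w n ∈ R` and positive `ε n → 0` with `ε n * w n → ζ`. -/
def asympDirs (R : Set ℂ) : Set ℂ :=
  {ζ : ℂ | ‖ζ‖ = 1 ∧ ∃ w : ℕ → ℂ, (∀ n, w n ∈ R) ∧ ∃ ε : ℕ → ℝ,
    (∀ n, 0 < ε n) ∧ Tendsto ε atTop (nhds 0) ∧
    Tendsto (fun n => (ε n : ℂ) * w n) atTop (nhds ζ)}

/-- `supOn u z r` is `M(u,z,r) = sup {u w : |w - z| ≤ r}`. -/
noncomputable def supOn (u : ℂ → ℝ) (z : ℂ) (r : ℝ) : ℝ :=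
  sSup (u '' Metric.closedBall z r)

/-- Subharmonic: upper semicontinuous and lies below every harmonic function dominating it on
the boundary of any disc. -/
def SubharmonicFn (w : ℂ → ℝ) : Prop :=
  UpperSemicontinuous w ∧
    ∀ (z₀ : ℂ) (r : ℝ), 0 < r → ∀ h : ℂ → ℝ,
      HarmonicOnSet h (Metric.ball z₀ r) → ContinuousOn h (Metric.closedBall z₀ r) →
      (∀ ζ ∈ Metric.sphere z₀ r, w ζ ≤ h ζ) → ∀ ζ ∈ Metric.closedBall z₀ r, w ζ ≤ h ζ

open InnerProductSpace in
/-- A function that is harmonic in the sense of `HarmonicFn` is harmonic in Mathlib's sense. -/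
theorem HarmonicFn.harmonicOnNhd {u : ℂ → ℝ} (hu : HarmonicFn u) (s : Set ℂ) :
    HarmonicOnNhd u s := by
  refine fun x _ => ⟨hu.1.contDiffAt, Eventually.of_forall fun y => ?_⟩
  rw [laplacian_eq_iteratedFDeriv_complexPlane]
  exact hu.2 y

theorem HarmonicFn.neg {u : ℂ → ℝ} (hu : HarmonicFn u) : HarmonicFn (-u) := by
  refine ⟨hu.1.neg, fun z => ?_⟩
  have h := hu.2 z
  simp only [iteratedFDeriv_neg, Pi.neg_apply, neg_apply]
  linarith

/-- **Liouville's theorem**: a harmonic function on the plane that is bounded above is constant. -/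
theorem HarmonicFn.const_of_le {u : ℂ → ℝ} (hu : HarmonicFn u) {M : ℝ} (hM : ∀ z, u z ≤ M) :
    ∃ c : ℝ, ∀ z, u z = c := by
  obtain ⟨F, hF, rfl⟩ := (hu.harmonicOnNhd univ).exists_analyticOnNhd_univ_re_eq
  have hexp : ∀ z w, Complex.exp (F z) = Complex.exp (F w) := by
    apply Differentiable.apply_eq_apply_of_bounded
    · exact differentiable_exp.comp fun x => (hF x (mem_univ x)).differentiableAt
    · rw [isBounded_iff_forall_norm_le]
      refine ⟨Real.exp M, ?_⟩
      rintro _ ⟨z, rfl⟩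
      simpa [Complex.norm_exp] using hM z
  refine ⟨(F 0).re, fun z => ?_⟩
  simpa [Complex.norm_exp] using congrArg norm (hexp z 0)

/-- A nonconstant harmonic function on the plane takes arbitrarily large values. -/
theorem HarmonicFn.exists_gt {u : ℂ → ℝ} (hu : HarmonicFn u) (hc : ¬ ∃ c : ℝ, ∀ z, u z = c)
    (M : ℝ) : ∃ z, M < u z := by
  by_contra! h
  exact hc (hu.const_of_le h)

/-- A nonconstant harmonic function on the plane has a zero. -/
theorem HarmonicFn.exists_eq_zero {u : ℂ → ℝ} (hu : HarmonicFn u)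
    (hc : ¬ ∃ c : ℝ, ∀ z, u z = c) : ∃ z, u z = 0 := by
  obtain ⟨a, ha⟩ := hu.exists_gt hc 0
  obtain ⟨b, hb⟩ := hu.neg.exists_gt
    (fun ⟨c, h⟩ => hc ⟨-c, fun z => by have := h z; simp at this; linarith⟩) 0
  simp only [Pi.neg_apply] at hb
  exact mem_range_of_exists_le_of_exists_ge hu.1.continuous ⟨b, by linarith⟩ ⟨a, ha.le⟩

open InnerProductSpace in
/-- **Harnack's inequality** on a disc. -/
theorem InnerProductSpace.HarmonicOnNhd.harnack_le {f : ℂ → ℝ} {c w : ℂ} {R : ℝ}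
    (hf : HarmonicOnNhd f (closedBall c R)) (hpos : ∀ z ∈ closedBall c R, 0 ≤ f z)
    (hw : w ∈ ball c R) : (R - ‖w - c‖) / (R + ‖w - c‖) * f c ≤ f w := by
  have hR : 0 < R := pos_of_mem_ball hw
  have hfc : ContinuousOn f (sphere c R) := hf.continuousOn.mono sphere_subset_closedBall
  rw [← hf.circleAverage_re_herglotzRieszKernel_smul hw]
  have hmean : Real.circleAverage f c R = f c := by
    apply HarmonicOnNhd.circleAverage_eq
    rwa [abs_of_pos hR]
  rw [← hmean, ← smul_eq_mul, ← Real.circleAverage_smul]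
  apply Real.circleAverage_mono
  · exact (hfc.const_smul _).circleIntegrable hR.le
  · apply ContinuousOn.circleIntegrable hR.le
    refine ContinuousOn.smul ?_ hfc
    refine Complex.continuous_re.comp_continuousOn ?_
    rw [herglotzRieszKernel_fun_def]
    refine ContinuousOn.div (by fun_prop) (by fun_prop) fun x hx h0 => ?_
    have : x = w := by linear_combination h0
    subst this
    exact absurd (mem_sphere.1 hx) (mem_ball.1 hw).ne
  · intro z hz
    rw [abs_of_pos hR] at hz
    have := le_re_herglotzRieszKernel hz hw
    simp only [Pi.smul_apply, smul_eq_mul, Function.comp_apply, Pi.smul_apply']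
    rw [herglotzRieszKernel_def]
    exact mul_le_mul_of_nonneg_right this (hpos z (sphere_subset_closedBall hz))

theorem le_supOn {u : ℂ → ℝ} (hu : Continuous u) {z w : ℂ} {r : ℝ} (hw : dist w z ≤ r) :
    u w ≤ supOn u z r :=
  le_csSup ((isCompact_closedBall z r).image hu).bddAbove ⟨w, hw, rfl⟩

theorem supOn_le {u : ℂ → ℝ} {z : ℂ} {r a : ℝ} (hr : 0 ≤ r)
    (h : ∀ w, dist w z ≤ r → u w ≤ a) : supOn u z r ≤ a := by
  apply csSup_le ((nonempty_closedBall.2 hr).image u)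
  rintro _ ⟨w, hw, rfl⟩
  exact h w hw

/-- If `u p ≤ A` holds as soon as the harmonic function `u` has a zero close to `p`, then
`u p ≤ 5 * A` follows from `u q ≤ A` at a single point `q` near `p`. -/
theorem HarmonicFn.le_five_mul {u : ℂ → ℝ} (hu : HarmonicFn u) {p q : ℂ} {s A : ℝ} (hs : 0 < s)
    (hA : 0 ≤ A) (hzero : ∀ w, dist p w ≤ 3 / 4 * s → u w = 0 → u p ≤ A)
    (hpq : dist q p ≤ s / 2) (hq : u q ≤ A) : u p ≤ 5 * A := by
  by_cases hex : ∃ w, dist p w ≤ 3 / 4 * s ∧ u w = 0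
  · obtain ⟨w, hw, hw0⟩ := hex
    linarith [hzero w hw hw0]
  push Not at hex
  rcases le_or_gt (u p) 0 with hp | hp
  · linarith
  have hpos : ∀ z ∈ closedBall p (3 / 4 * s), 0 ≤ u z := by
    intro z hz
    by_contra! hz0
    obtain ⟨w, hw, hw0⟩ := (convex_closedBall p (3 / 4 * s)).isPreconnected.intermediate_value hz
      (mem_closedBall_self (by positivity)) hu.1.continuous.continuousOn
      (show (0 : ℝ) ∈ Icc (u z) (u p) from ⟨hz0.le, hp.le⟩)
    exact hex w (by rw [dist_comm]; exact hw) hw0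
  have hH := (hu.harmonicOnNhd (closedBall p (3 / 4 * s))).harnack_le hpos (w := q)
    (by rw [mem_ball]; linarith)
  rw [dist_eq_norm] at hpq
  have hn := norm_nonneg (q - p)
  rw [div_mul_eq_mul_div, div_le_iff₀ (by positivity)] at hH
  nlinarith

/-- Lewis' lemma: near a zero of a harmonic function there is a disc, centred at a zero, on which
the function is doubling and not much smaller than on the given disc. -/
theorem HarmonicFn.exists_doubling_disc {u : ℂ → ℝ} (hu : HarmonicFn u) {z₀ : ℂ} (hz₀ : u z₀ = 0)
    {R : ℝ} (hR : 0 < R) (hpos : 0 < supOn u z₀ (R / 12)) :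
    ∃ z ρ, 0 < ρ ∧ u z = 0 ∧ supOn u z₀ (R / 12) ≤ 2 * supOn u z (ρ / 2) ∧
      supOn u z ρ ≤ 50 * supOn u z (ρ / 2) := by
  have hcont : Continuous u := hu.1.continuous
  set S : Set ℝ :=
    (fun z => supOn u z ((R - dist z z₀) / 12)) '' {z | dist z z₀ < R ∧ u z = 0} with hS
  have hbdd : BddAbove S := by
    refine ⟨supOn u z₀ (2 * R), ?_⟩
    rintro _ ⟨z, ⟨hz, -⟩, rfl⟩
    refine supOn_le (by linarith) fun w hw => le_supOn hcont ?_
    linarith [dist_triangle w z z₀, dist_nonneg (x := z) (y := z₀)]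
  have hmem : supOn u z₀ (R / 12) ∈ S := ⟨z₀, ⟨by simpa using hR, hz₀⟩, by simp⟩
  set m := sSup S with hm
  have hle : supOn u z₀ (R / 12) ≤ m := le_csSup hbdd hmem
  have hm0 : 0 < m := hpos.trans_le hle
  obtain ⟨_, ⟨z, ⟨hzR, hz0⟩, rfl⟩, hz⟩ := exists_lt_of_lt_csSup ⟨_, hmem⟩ (half_lt_self hm0)
  simp only at hz
  set s := (R - dist z z₀) / 12 with hs
  have hs0 : 0 < s := by rw [hs]; linarith
  have hzm : supOn u z s ≤ m := le_csSup hbdd ⟨z, ⟨hzR, hz0⟩, rfl⟩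
  have hzero : ∀ p, dist p z ≤ 2 * s → ∀ w, dist p w ≤ 3 / 4 * s → u w = 0 → u p ≤ m := by
    intro p hp w hw hw0
    have hwz₀ : dist w z₀ ≤ dist z z₀ + 11 / 4 * s := by
      linarith [dist_triangle w z z₀, dist_triangle_left w z p]
    have hwR : dist w z₀ < R := by linarith
    exact (le_supOn hcont (by linarith)).trans (le_csSup hbdd ⟨w, ⟨hwR, hw0⟩, rfl⟩)
  have hbound : supOn u z (2 * s) ≤ 25 * m := by
    refine supOn_le (by positivity) fun p hp => ?_
    have hnorm : ‖p - z‖ ≤ 2 * s := by rwa [← dist_eq_norm]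
    have hdist : ∀ a b : ℝ, dist (z + a * (p - z)) (z + b * (p - z)) = |a - b| * ‖p - z‖ := by
      intro a b
      rw [dist_eq_norm, ← Real.norm_eq_abs, ← Complex.norm_real, ← norm_mul]
      congr 1
      push_cast
      ring
    have h0 : ∀ a : ℝ, dist (z + a * (p - z)) z = |a| * ‖p - z‖ := by
      intro a
      simp
    have h1 : ∀ a : ℝ, dist (z + a * (p - z)) p = |a - 1| * ‖p - z‖ := by
      intro a
      simpa using hdist a 1
    have hq : u (z + (1 / 2 : ℝ) * (p - z)) ≤ m := by
      refine (le_supOn hcont ?_).trans hzm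
      rw [h0, abs_of_pos (by norm_num)]
      linarith
    have hq' : u (z + (3 / 4 : ℝ) * (p - z)) ≤ 5 * m := by
      refine hu.le_five_mul hs0 hm0.le (hzero _ ?_) ?_ hq
      · rw [h0, abs_of_pos (by norm_num)]
        linarith [norm_nonneg (p - z)]
      · rw [hdist]
        norm_num [abs_of_pos]
        linarith
    have hp' : u p ≤ 5 * (5 * m) := by
      refine hu.le_five_mul hs0 (by positivity)
        (fun w hw hw0 => (hzero p hp w hw hw0).trans (by linarith)) ?_ hq'
      rw [h1]
      norm_num [abs_of_pos]
      linarith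
    linarith
  refine ⟨z, 2 * s, by positivity, hz0, ?_, ?_⟩ <;> rw [mul_div_cancel_left₀ s two_ne_zero] <;>
    linarith

/-- **Corollary 3.2.** There is an absolute constant `C > 0` such that for every nonconstant
entire harmonic `u` there are discs `D(z_n, ρ_n)` with `u(z_n) = 0`, `M(u,z_n,ρ_n) → ∞` and
`M(u,z_n,ρ_n) ≤ C·M(u,z_n,ρ_n/2)`. -/
theorem lewis_discs_sequence :
    ∃ C : ℝ, 0 < C ∧ ∀ u : ℂ → ℝ, HarmonicFn u → (¬ ∃ c : ℝ, ∀ z, u z = c) →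
      ∃ z : ℕ → ℂ, ∃ ρ : ℕ → ℝ, (∀ n, 0 < ρ n) ∧ (∀ n, u (z n) = 0) ∧
        Tendsto (fun n => supOn u (z n) (ρ n)) atTop atTop ∧
        ∀ n, supOn u (z n) (ρ n) ≤ C * supOn u (z n) (ρ n / 2) := by
  refine ⟨50, by norm_num, fun u hu hc => ?_⟩
  obtain ⟨z₀, hz₀⟩ := hu.exists_eq_zero hc
  have hcont : Continuous u := hu.1.continuous
  have hdisc : ∀ n : ℕ, ∃ z ρ, 0 < ρ ∧ u z = 0 ∧ (n : ℝ) ≤ supOn u z ρ ∧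
      supOn u z ρ ≤ 50 * supOn u z (ρ / 2) := by
    intro n
    obtain ⟨a, ha⟩ := hu.exists_gt hc (2 * n)
    have hR : 0 < 12 * (dist a z₀ + 1) := by positivity
    have haR : u a ≤ supOn u z₀ (12 * (dist a z₀ + 1) / 12) := le_supOn hcont (by linarith)
    have hn : (0 : ℝ) ≤ n := n.cast_nonneg
    obtain ⟨z, ρ, hρ, hz, h1, h2⟩ := hu.exists_doubling_disc hz₀ hR (by linarith)
    have hmono : supOn u z (ρ / 2) ≤ supOn u z ρ :=
      supOn_le (by positivity) fun w hw => le_supOn hcont (by linarith)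
    exact ⟨z, ρ, hρ, hz, by linarith, h2⟩
  choose z ρ hρ hz hlarge hdouble using hdisc
  exact ⟨z, ρ, hρ, hz, tendsto_atTop_mono hlarge tendsto_natCast_atTop_atTop, hdouble⟩
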